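/- Let q ∈ {1,…,n} and let A = {a_1, …, a_{n−1}} = {1,…,n}∖{q}. The n−1 vectors f^{(n)}_{A∖{a_i}} ∈ F^n, for i = 1, 2, …, n−1, span a linear subspace of F^n of dimension exactly ⌊(n−1)/2⌋. -/

import Mathlib

/-- The vector `f^{(n)}_S ∈ F^n` associated to an `(n−3)`-simplex with vertex set `S`
(`|S| = n−2`): its `r`-th component is `∑_{T ⊆ S∖{r}, |T| = ⌊n/2⌋} 1/∏_{t∈T}(ζ_r − ζ_t)`
for `r ∈ S`, and `0` for `r ∉ S`. -/
def fvec {F : Type*} [Field F] {n : ℕ} (ζ : Fin n → F) (S : Finset (Fin n)) : Fin n → F :=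
  fun r => if r ∈ S then
    ∑ T ∈ (S.erase r).powersetCard (n / 2), (∏ t ∈ T, (ζ r - ζ t))⁻¹
  else 0

open Polynomial Finset Lagrange

/-- Over nonzero constants, the `k`-th coefficient of `∏ (X + b t)` is the `k`-th elementary
symmetric function of the `(b t)⁻¹`, rescaled by `∏ b t`. -/
theorem coeff_prod_X_add_C_eq_prod_mul_sum_inv {F ι : Type*} [Field F] [DecidableEq ι]
    (s : Finset ι) (b : ι → F) (hb : ∀ i ∈ s, b i ≠ 0) (k : ℕ) :
    (∏ i ∈ s, (X + C (b i))).coeff k =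
      (∏ i ∈ s, b i) * ∑ T ∈ s.powersetCard k, (∏ t ∈ T, b t)⁻¹ := by
  rw [Finset.prod_add, finsetSum_coeff, powersetCard_eq_filter, Finset.sum_filter,
    Finset.mul_sum]
  refine Finset.sum_congr rfl fun T hT => ?_
  rw [Finset.mem_powerset] at hT
  rw [Finset.prod_const, ← map_prod, coeff_mul_C, coeff_X_pow]
  by_cases h : #T = k
  · have hne : ∏ t ∈ T, b t ≠ 0 := Finset.prod_ne_zero_iff.2 fun t ht => hb t (hT ht)
    rw [if_pos h.symm, if_pos h, one_mul, ← Finset.prod_sdiff hT, mul_assoc,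
      mul_inv_cancel₀ hne, mul_one]
  · rw [if_neg (Ne.symm h), if_neg h, zero_mul, mul_zero]

theorem taylor_nodal {R ι : Type*} [CommRing R] (s : Finset ι) (v : ι → R) (x : R) :
    taylor x (nodal s v) = ∏ i ∈ s, (X + C (x - v i)) := by
  rw [nodal_eq, taylor_apply, Polynomial.prod_comp]
  refine Finset.prod_congr rfl fun i _ => ?_
  simp only [sub_comp, X_comp, C_comp, C_sub]
  ring

/-- The nodal polynomials of the sets obtained by deleting one node span the polynomials of degree
less than the number of nodes. -/
theorem span_nodal_erase {F ι : Type*} [Field F] [DecidableEq ι] (s : Finset ι) (v : ι → F)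
    (hv : Set.InjOn v s) :
    Submodule.span F ((fun a => nodal (s.erase a) v) '' (s : Set ι)) = degreeLT F #s := by
  apply le_antisymm
  · rw [Submodule.span_le]
    rintro _ ⟨a, ha, rfl⟩
    rw [SetLike.mem_coe, mem_degreeLT, degree_nodal]
    exact_mod_cast Finset.card_erase_lt_of_mem ha
  · intro p hp
    rw [eq_interpolate hv (mem_degreeLT.1 hp), interpolate_apply]
    refine Submodule.sum_mem _ fun a ha => ?_
    have hbasis : Lagrange.basis s v a =
        C (∏ j ∈ s.erase a, (v a - v j)⁻¹) * nodal (s.erase a) v := by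
      simp_rw [Lagrange.basis, basisDivisor, Finset.prod_mul_distrib, map_prod, nodal_eq]
    rw [hbasis, ← mul_assoc, ← C_mul, ← smul_eq_C_mul]
    exact Submodule.smul_mem _ _ (Submodule.subset_span ⟨a, ha, rfl⟩)

/-- In characteristic zero the `k`-th Hasse derivative maps polynomials of degree less than `d + k`
onto those of degree less than `d`. -/
theorem exists_hasseDeriv_eq {F : Type*} [Field F] [CharZero F] (k d : ℕ) {p : F[X]}
    (hp : p ∈ degreeLT F d) : ∃ P ∈ degreeLT F (d + k), hasseDeriv k P = p := by
  refine ⟨∑ j ∈ range d, monomial (j + k) (p.coeff j / (j + k).choose k), ?_, ?_⟩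
  · refine Submodule.sum_mem _ fun j hj => mem_degreeLT.2 ((degree_monomial_le _ _).trans_lt ?_)
    have := Finset.mem_range.1 hj
    exact_mod_cast (by omega : j + k < d + k)
  · have hp' := (degree_lt_iff_coeff_zero _ _).1 (mem_degreeLT.1 hp)
    ext i
    have hne : ((i + k).choose k : F) ≠ 0 :=
      Nat.cast_ne_zero.2 (Nat.choose_pos (Nat.le_add_left k i)).ne'
    simp only [hasseDeriv_coeff, finsetSum_coeff, coeff_monomial, Nat.add_right_cancel_iff,
      Finset.sum_ite_eq', Finset.mem_range]
    split_ifs with hi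
    · rw [mul_div_cancel₀ _ hne]
    · rw [mul_zero, hp' i (not_lt.1 hi)]

theorem hasseDeriv_mem_degreeLT {R : Type*} [Semiring R] (k d : ℕ) {p : R[X]}
    (hp : p ∈ degreeLT R (d + k)) : hasseDeriv k p ∈ degreeLT R d := by
  rw [mem_degreeLT, degree_lt_iff_coeff_zero] at hp ⊢
  intro i hi
  rw [hasseDeriv_coeff, hp _ (Nat.add_le_add_right hi k), mul_zero]

/-- The linear map sending `nodal (s.erase a) v` to
`(X - C (v a)) * hasseDeriv (k + 1) (nodal (s.erase a) v)`; see `eval_hasseDefect_nodal_erase`. -/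
noncomputable def hasseDefect {F ι : Type*} [Field F] (s : Finset ι) (v : ι → F) (k : ℕ) :
    F[X] →ₗ[F] F[X] :=
  (lcoeff F (#s - 1)).smulRight (hasseDeriv (k + 1) (nodal s v)) - hasseDeriv k

theorem hasseDefect_apply {F ι : Type*} [Field F] (s : Finset ι) (v : ι → F) (k : ℕ) (p : F[X]) :
    hasseDefect s v k p =
      p.coeff (#s - 1) • hasseDeriv (k + 1) (nodal s v) - hasseDeriv k p :=
  rfl

theorem eval_hasseDefect_nodal_erase {F ι : Type*} [Field F] [DecidableEq ι] (s : Finset ι)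
    (v : ι → F) (k : ℕ) {a : ι} (ha : a ∈ s) (x : F) :
    (hasseDefect s v k (nodal (s.erase a) v)).eval x =
      (x - v a) * (taylor x (nodal (s.erase a) v)).coeff (k + 1) := by
  have hlead : (nodal (s.erase a) v).coeff (#s - 1) = 1 := by
    rw [← Finset.card_erase_of_mem ha, ← natDegree_nodal (R := F) (v := v)]
    exact nodal_monic.coeff_natDegree
  rw [hasseDefect_apply, hlead, one_smul, eval_sub, ← taylor_coeff, ← taylor_coeff,
    nodal_eq_mul_nodal_erase ha, taylor_mul, map_sub, taylor_X, taylor_C, add_sub_assoc, ← C_sub,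
    add_mul, coeff_add, coeff_X_mul, coeff_C_mul]
  ring

theorem map_hasseDefect_degreeLT {F ι : Type*} [Field F] [CharZero F] (s : Finset ι) (v : ι → F)
    (k : ℕ) (hk : k + 2 ≤ #s) :
    (degreeLT F #s).map (hasseDefect s v k) = degreeLT F (#s - k) := by
  obtain ⟨d, hd⟩ : ∃ d, #s = d + 2 + k := ⟨#s - k - 2, by omega⟩
  have hnodal : hasseDeriv (k + 1) (nodal s v) ∈ degreeLT F (d + 2) := by
    refine hasseDeriv_mem_degreeLT _ _ (mem_degreeLT.2 ?_)
    rw [degree_nodal, hd]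
    exact_mod_cast (by omega : d + 2 + k < d + 2 + (k + 1))
  have hlead : (nodal s v).coeff (d + 1 + (k + 1)) = 1 := by
    rw [show d + 1 + (k + 1) = #s by omega, ← natDegree_nodal (R := F) (v := v)]
    exact nodal_monic.coeff_natDegree
  have hdk : #s - k = d + 2 := by omega
  rw [hdk]
  apply le_antisymm
  · rintro _ ⟨p, hp, rfl⟩
    rw [SetLike.mem_coe, hd] at hp
    rw [hasseDefect_apply]
    exact Submodule.sub_mem _ (Submodule.smul_mem _ _ hnodal) (hasseDeriv_mem_degreeLT _ _ hp)
  · intro p hp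
    have hne : ((d + 1 + k).choose (k + 1) : F) ≠ 0 :=
      Nat.cast_ne_zero.2 (Nat.choose_pos (by omega)).ne'
    have hne' : ((d + 1 + k).choose k : F) ≠ 0 :=
      Nat.cast_ne_zero.2 (Nat.choose_pos (by omega)).ne'
    set c := p.coeff (d + 1) / (d + 1 + k).choose (k + 1) with hc
    obtain ⟨P, hP, hPc⟩ := exists_hasseDeriv_eq k (d + 2)
      (Submodule.sub_mem _ (Submodule.smul_mem _ c hnodal) hp)
    refine ⟨P, hd ▸ hP, ?_⟩
    have hcoeff : P.coeff (#s - 1) = c := by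
      have h := congrArg (fun f => f.coeff (d + 1)) hPc
      have hpc : p.coeff (d + 1) = c * (d + 1 + k).choose (k + 1) := by
        rw [hc, div_mul_cancel₀ _ hne]
      simp only [coeff_sub, coeff_smul, hasseDeriv_coeff, hlead, smul_eq_mul, hpc] at h
      rw [← add_assoc, Nat.choose_succ_succ, Nat.cast_add] at h
      rw [show #s - 1 = d + 1 + k by omega]
      apply mul_left_cancel₀ hne'
      linear_combination h
    rw [hasseDefect_apply, hcoeff, hPc, sub_sub_cancel]

/-- Evaluation at the nodes of `s`, weighted by the nodal weights and extended by zero. -/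
noncomputable def weightedEval {F ι : Type*} [Field F] [DecidableEq ι] (s : Finset ι)
    (v : ι → F) : F[X] →ₗ[F] ι → F :=
  LinearMap.pi fun r => if r ∈ s then nodalWeight s v r • leval (v r) else 0

theorem weightedEval_apply {F ι : Type*} [Field F] [DecidableEq ι] (s : Finset ι)
    (v : ι → F) (p : F[X]) (r : ι) :
    weightedEval s v p r = if r ∈ s then nodalWeight s v r * p.eval (v r) else 0 := by
  rw [weightedEval, LinearMap.pi_apply]
  split_ifs <;> rfl

theorem finrank_map_weightedEval_degreeLT {F ι : Type*} [Field F] [DecidableEq ι] (s : Finset ι)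
    (v : ι → F) (hv : Set.InjOn v s) {d : ℕ} (hd : d ≤ #s) :
    Module.finrank F ((degreeLT F d).map (weightedEval s v)) = d := by
  have hinj : Function.Injective ((weightedEval s v).domRestrict (degreeLT F d)) := by
    rw [← LinearMap.ker_eq_bot, LinearMap.ker_eq_bot']
    rintro ⟨p, hp⟩ h
    rw [LinearMap.domRestrict_apply] at h
    have hdeg : p.degree < #s := (mem_degreeLT.1 hp).trans_le (by exact_mod_cast hd)
    refine Subtype.ext (eq_zero_of_degree_lt_of_eval_index_eq_zero s hv hdeg fun r hr => ?_)
    have hr' := congrFun h r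
    rw [weightedEval_apply, if_pos hr] at hr'
    exact (mul_eq_zero.1 hr').resolve_left (nodalWeight_ne_zero hv hr)
  rw [← LinearMap.range_domRestrict, LinearMap.finrank_range_of_inj hinj,
    (degreeLTEquiv F d).finrank_eq, Module.finrank_fin_fun]

theorem fvec_erase_eq_weightedEval {F : Type*} [Field F] {n : ℕ} (ζ : Fin n → F)
    (hζ : Function.Injective ζ) (s : Finset (Fin n)) {a : Fin n} (ha : a ∈ s) :
    fvec ζ (s.erase a) =
      weightedEval s ζ (hasseDefect s ζ (n / 2) (nodal (s.erase a) ζ)) := by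
  ext r
  rw [weightedEval_apply, eval_hasseDefect_nodal_erase s ζ _ ha, fvec]
  by_cases hr : r ∈ s
  · rw [if_pos hr]
    rcases eq_or_ne r a with rfl | hra
    · simp
    · have hra' : r ∈ s.erase a := Finset.mem_erase.2 ⟨hra, hr⟩
      have hsub : ∀ t ∈ (s.erase a).erase r, ζ r - ζ t ≠ 0 := fun t ht =>
        sub_ne_zero.2 (hζ.ne (Finset.ne_of_mem_erase ht).symm)
      have hprod := Finset.prod_ne_zero_iff.2 hsub
      have har : ζ r - ζ a ≠ 0 := sub_ne_zero.2 (hζ.ne hra)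
      have hweight : nodalWeight s ζ r =
          ((ζ r - ζ a) * ∏ t ∈ (s.erase a).erase r, (ζ r - ζ t))⁻¹ := by
        rw [nodalWeight, Finset.prod_inv_distrib, Finset.erase_right_comm,
          Finset.mul_prod_erase _ (fun t => ζ r - ζ t) (Finset.mem_erase.2 ⟨hra.symm, ha⟩)]
      rw [if_pos hra', taylor_nodal,
        ← Finset.mul_prod_erase _ (fun t => X + C (ζ r - ζ t)) hra', sub_self, C_0, add_zero,
        coeff_X_mul, coeff_prod_X_add_C_eq_prod_mul_sum_inv _ _ hsub, hweight, ← mul_assoc,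
        ← mul_assoc, mul_assoc _ (ζ r - ζ a), inv_mul_cancel₀ (mul_ne_zero har hprod), one_mul]
  · rw [if_neg hr, if_neg fun h => hr (Finset.mem_of_mem_erase h)]

/-- for `A = {1,…,n}∖{q}`, the `n−1` vectors `f^{(n)}_{A∖{a}}` for `a ∈ A`
span a linear subspace of `F^n` of dimension exactly `⌊(n−1)/2⌋`. -/
theorem stmt_3 (F : Type*) [Field F] [CharZero F] (n : ℕ) (hn : 5 ≤ n)
    (ζ : Fin n → F) (hζ : Function.Injective ζ) (q : Fin n) :
    Module.finrank F ↥(Submodule.span F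
      ((fun a => fvec ζ ((Finset.univ.erase q).erase a)) ''
        ↑(Finset.univ.erase q))) = (n - 1) / 2 := by
  have hcard : #(univ.erase q) = n - 1 := by
    rw [Finset.card_erase_of_mem (Finset.mem_univ q), Finset.card_univ, Fintype.card_fin]
  have himage : (fun a => fvec ζ ((univ.erase q).erase a)) '' ↑(univ.erase q) =
      weightedEval (univ.erase q) ζ '' (hasseDefect (univ.erase q) ζ (n / 2) ''
        ((fun a => nodal ((univ.erase q).erase a) ζ) '' ↑(univ.erase q))) := by
    rw [Set.image_image, Set.image_image]
    exact Set.image_congr fun a ha => fvec_erase_eq_weightedEval ζ hζ _ ha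
  rw [himage, Submodule.span_image, Submodule.span_image, span_nodal_erase _ _ hζ.injOn,
    map_hasseDefect_degreeLT _ _ _ (by omega),
    finrank_map_weightedEval_degreeLT _ _ hζ.injOn (Nat.sub_le _ _)]
  omega
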